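/- Let F : Γ₊ → (0,∞) be a smooth symmetric function on the positive cone Γ₊ ⊂ ℝⁿ, homogeneous of degree one and strictly increasing in each variable, and suppose that for all y ∈ ℝⁿ and κ ∈ Γ₊ one has ∑_{k,ℓ} (∂²F/∂κ_k∂κ_ℓ)(κ) y_k y_ℓ ≥ F(κ)⁻¹ (∑_k (∂F/∂κ_k)(κ) y_k)² − ∑_k (∂F/∂κ_k)(κ)/κ_k · y_k². Then the dual function F*(μ₁,…,μₙ) := 1/F(μ₁⁻¹,…,μₙ⁻¹) is concave on Γ₊ (i.e. F is inverse concave). -/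

import Mathlib

open Real Finset

/-- Euler's identity for a function that is positively homogeneous of degree one along the ray
through `κ`. -/
theorem fderiv_apply_self_of_homogeneous {E : Type*} [NormedAddCommGroup E] [NormedSpace ℝ E]
    {F : E → ℝ} {κ : E} (hF : DifferentiableAt ℝ F κ)
    (hhom : ∀ c : ℝ, 0 < c → F (c • κ) = c * F κ) : fderiv ℝ F κ κ = F κ := by
  have hray : HasDerivAt (fun c : ℝ => c • κ) κ 1 := by
    simpa using (hasDerivAt_id (1 : ℝ)).smul_const κ
  have hcomp : HasDerivAt (fun c : ℝ => F (c • κ)) (fderiv ℝ F κ κ) 1 := by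
    refine HasFDerivAt.comp_hasDerivAt (l := F) 1 ?_ hray
    rw [one_smul]
    exact hF.hasFDerivAt
  have hlin : HasDerivAt (fun c : ℝ => F (c • κ)) (F κ) 1 := by
    have h : HasDerivAt (fun c : ℝ => c * F κ) (F κ) 1 := by
      simpa using (hasDerivAt_id (1 : ℝ)).mul_const (F κ)
    refine h.congr_of_eventuallyEq ?_
    filter_upwards [lt_mem_nhds one_pos] with c hc using hhom c hc
  exact hcomp.unique hlin

/-- A continuous linear functional on `ι → ℝ` in coordinates. -/
theorem ContinuousLinearMap.apply_eq_sum_single {ι : Type*} [Fintype ι] [DecidableEq ι]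
    (L : (ι → ℝ) →L[ℝ] ℝ) (v : ι → ℝ) : L v = ∑ k, L (Pi.single k 1) * v k := by
  conv_lhs => rw [pi_eq_sum_univ' v]
  simp [map_sum, mul_comm]

/-- Weighted Cauchy-Schwarz inequality. -/
theorem sum_mul_sq_le_sum_mul_mul_sum_div_mul_sq {ι : Type*} (s : Finset ι) {w κ : ι → ℝ}
    (hw : ∀ k ∈ s, 0 ≤ w k) (hκ : ∀ k ∈ s, 0 < κ k) (y : ι → ℝ) :
    (∑ k ∈ s, w k * y k) ^ 2 ≤ (∑ k ∈ s, w k * κ k) * ∑ k ∈ s, w k / κ k * y k ^ 2 := by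
  refine sum_sq_le_sum_mul_sum_of_sq_le_mul s (fun k hk => mul_nonneg (hw k hk) (hκ k hk).le)
    (fun k hk => mul_nonneg (div_nonneg (hw k hk) (hκ k hk).le) (sq_nonneg _)) (fun k hk => le_of_eq ?_)
  have := (hκ k hk).ne'
  field_simp

/-- A reciprocal `1 / G` is concave on `[0, 1]` as soon as `G * G'' ≥ 2 * G' ^ 2`. -/
theorem concaveOn_inv_of_two_mul_sq_le {G G' G'' : ℝ → ℝ}
    (hG : ∀ t ∈ Set.Icc (0 : ℝ) 1, HasDerivAt G (G' t) t)
    (hG' : ∀ t ∈ Set.Icc (0 : ℝ) 1, HasDerivAt G' (G'' t) t)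
    (hpos : ∀ t ∈ Set.Icc (0 : ℝ) 1, 0 < G t)
    (hle : ∀ t ∈ Set.Icc (0 : ℝ) 1, 2 * G' t ^ 2 ≤ G t * G'' t) :
    ConcaveOn ℝ (Set.Icc (0 : ℝ) 1) (fun t => (G t)⁻¹) := by
  have hinv : ∀ t ∈ Set.Icc (0 : ℝ) 1, HasDerivAt (fun t => (G t)⁻¹) (-G' t / G t ^ 2) t :=
    fun t ht => (hG t ht).fun_inv (hpos t ht).ne'
  refine concaveOn_of_hasDerivWithinAt2_nonpos (convex_Icc 0 1)
    (fun t ht => (hinv t ht).continuousAt.continuousWithinAt)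
    (fun t ht => (hinv t (interior_subset ht)).hasDerivWithinAt)
    (fun t ht => (((hG' t (interior_subset ht)).fun_neg.fun_div
      ((hG t (interior_subset ht)).fun_pow 2)
      (pow_ne_zero 2 (hpos t (interior_subset ht)).ne')).hasDerivWithinAt))
    (fun t ht => ?_)
  have hp := hpos t (interior_subset ht)
  have h := hle t (interior_subset ht)
  refine div_nonpos_of_nonpos_of_nonneg ?_ (by positivity)
  have := mul_le_mul_of_nonneg_left h hp.le
  norm_num
  nlinarith

/-- A smooth symmetric, degree-one homogeneous, strictly monotone function
on the positive cone satisfying condition (ii) of the Assumption is inverse concave. -/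
theorem stmt_0 (n : ℕ) (F : (Fin n → ℝ) → ℝ)
    (hpos : ∀ κ : Fin n → ℝ, (∀ i, 0 < κ i) → 0 < F κ)
    (hsmooth : ∀ κ : Fin n → ℝ, (∀ i, 0 < κ i) → ContDiffAt ℝ (⊤ : ℕ∞) F κ)
    (hsymm : ∀ (σ : Equiv.Perm (Fin n)) (κ : Fin n → ℝ), F (κ ∘ σ) = F κ)
    (hhom : ∀ (c : ℝ) (κ : Fin n → ℝ), 0 < c → (∀ i, 0 < κ i) → F (c • κ) = c * F κ)
    (hmono : ∀ κ : Fin n → ℝ, (∀ i, 0 < κ i) → ∀ k, 0 < fderiv ℝ F κ (Pi.single k 1))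
    (hineq : ∀ κ : Fin n → ℝ, (∀ i, 0 < κ i) → ∀ y : Fin n → ℝ,
      (F κ)⁻¹ * (∑ k, fderiv ℝ F κ (Pi.single k 1) * y k) ^ 2
          - ∑ k, fderiv ℝ F κ (Pi.single k 1) / κ k * y k ^ 2 ≤
        ∑ k, ∑ l, fderiv ℝ (fun x => fderiv ℝ F x (Pi.single k 1)) κ (Pi.single l 1)
          * y k * y l) :
    ConcaveOn ℝ {κ : Fin n → ℝ | ∀ i, 0 < κ i}
      (fun μ : Fin n → ℝ => (F (fun i => (μ i)⁻¹))⁻¹) := by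
  have hcurve : ∀ {p : ℝ} (q t : ℝ), 0 < p + t * q →
      HasDerivAt (fun t : ℝ => (p + t * q)⁻¹) (-q / (p + t * q) ^ 2) t := fun {p} q t h =>
    (((hasDerivAt_id t).mul_const q).const_add p |>.fun_inv h.ne').congr_deriv (by simp)
  have hcurve' : ∀ {p : ℝ} (q t : ℝ), 0 < p + t * q →
      HasDerivAt (fun t : ℝ => -q / (p + t * q) ^ 2) (2 * q ^ 2 / (p + t * q) ^ 3) t := by
    intro p q t h
    have hl : HasDerivAt (fun t : ℝ => p + t * q) q t := by
      simpa using ((hasDerivAt_id t).mul_const q).const_add p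
    refine ((hasDerivAt_const t (-q)).fun_div (hl.fun_pow 2) (pow_ne_zero 2 h.ne')).congr_deriv ?_
    have := h.ne'
    field_simp
    norm_num
    ring
  have hdiff : ∀ κ : Fin n → ℝ, (∀ i, 0 < κ i) → DifferentiableAt ℝ F κ := fun κ hκ =>
    (hsmooth κ hκ).differentiableAt (by simp)
  have hdiff' : ∀ κ : Fin n → ℝ, (∀ i, 0 < κ i) → ∀ k,
      DifferentiableAt ℝ (fun x => fderiv ℝ F x (Pi.single k 1)) κ := fun κ hκ k =>
    (((hsmooth κ hκ).fderiv_right (m := 1) (WithTop.coe_le_coe.2 le_top)).differentiableAt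
      (by simp)).clm_apply (differentiableAt_const _)
  have hconv : Convex ℝ {κ : Fin n → ℝ | ∀ i, 0 < κ i} := by
    intro x hx y hy a b ha hb hab i
    exact convex_Ioi (0 : ℝ) (hx i) (hy i) ha hb hab
  refine ⟨hconv, fun μ hμ ν hν a b ha hb hab => ?_⟩
  have hseg : ∀ t ∈ Set.Icc (0 : ℝ) 1, ∀ i, 0 < μ i + t * (ν i - μ i) := fun t ht i => by
    have := hconv hμ hν (sub_nonneg.2 ht.2) ht.1 (by ring) i
    simp only [Pi.add_apply, Pi.smul_apply, smul_eq_mul] at this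
    linarith
  set κ : ℝ → Fin n → ℝ := fun t i => (μ i + t * (ν i - μ i))⁻¹ with hκdef
  set y : ℝ → Fin n → ℝ := fun t i => -(ν i - μ i) / (μ i + t * (ν i - μ i)) ^ 2 with hydef
  have hκpos : ∀ t ∈ Set.Icc (0 : ℝ) 1, ∀ i, 0 < κ t i := fun t ht i => inv_pos.2 (hseg t ht i)
  have hκ : ∀ t ∈ Set.Icc (0 : ℝ) 1, HasDerivAt κ (y t) t := fun t ht =>
    hasDerivAt_pi.2 fun i => hcurve _ _ (hseg t ht i)
  have hy : ∀ t ∈ Set.Icc (0 : ℝ) 1, ∀ i,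
      HasDerivAt (fun t => y t i) (2 * (y t i ^ 2 / κ t i)) t := fun t ht i =>
    (hcurve' _ _ (hseg t ht i)).congr_deriv (by
      have := (hseg t ht i).ne'
      simp only [hκdef, hydef]
      field_simp)
  have hconc : ConcaveOn ℝ (Set.Icc (0 : ℝ) 1) (fun t => (F (κ t))⁻¹) := by
    refine concaveOn_inv_of_two_mul_sq_le
      (G' := fun t => ∑ k, fderiv ℝ F (κ t) (Pi.single k 1) * y t k)
      (G'' := fun t => ∑ k,
        (fderiv ℝ (fun x => fderiv ℝ F x (Pi.single k 1)) (κ t) (y t) * y t k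
          + fderiv ℝ F (κ t) (Pi.single k 1) * (2 * (y t k ^ 2 / κ t k))))
      (fun t ht => ?_) (fun t ht => ?_) (fun t ht => hpos _ (hκpos t ht)) (fun t ht => ?_)
    · rw [← ContinuousLinearMap.apply_eq_sum_single]
      exact (hdiff _ (hκpos t ht)).hasFDerivAt.comp_hasDerivAt t (hκ t ht)
    · exact HasDerivAt.fun_sum fun k _ => HasDerivAt.fun_mul
        ((hdiff' _ (hκpos t ht) k).hasFDerivAt.comp_hasDerivAt t (hκ t ht)) (hy t ht k)
    · have hF := hpos _ (hκpos t ht)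
      have hcs := sum_mul_sq_le_sum_mul_mul_sum_div_mul_sq univ
        (fun k _ => (hmono _ (hκpos t ht) k).le) (fun k _ => hκpos t ht k) (y t)
      rw [← ContinuousLinearMap.apply_eq_sum_single (fderiv ℝ F (κ t)) (κ t), fderiv_apply_self_of_homogeneous
        (hdiff _ (hκpos t ht)) fun c hc => hhom c _ hc (hκpos t ht)] at hcs
      have hquad := mul_le_mul_of_nonneg_left (hineq _ (hκpos t ht) (y t)) hF.le
      rw [mul_sub, mul_inv_cancel_left₀ hF.ne'] at hquad
      have hhess : ∑ k, fderiv ℝ (fun x => fderiv ℝ F x (Pi.single k 1)) (κ t) (y t) * y t k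
          = ∑ k, ∑ l, fderiv ℝ (fun x => fderiv ℝ F x (Pi.single k 1)) (κ t) (Pi.single l 1)
            * y t k * y t l := sum_congr rfl fun k _ => by
        rw [ContinuousLinearMap.apply_eq_sum_single, sum_mul]
        exact sum_congr rfl fun l _ => by ring
      have hacc : ∑ k, fderiv ℝ F (κ t) (Pi.single k 1) * (2 * (y t k ^ 2 / κ t k))
          = 2 * ∑ k, fderiv ℝ F (κ t) (Pi.single k 1) / κ t k * y t k ^ 2 := by
        rw [mul_sum]
        exact sum_congr rfl fun k _ => by ring
      rw [sum_add_distrib, hhess, hacc]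
      linarith
  have h := hconc.2 (Set.left_mem_Icc.2 zero_le_one) (Set.right_mem_Icc.2 zero_le_one) ha hb hab
  have hb' : ∀ i, μ i + b * (ν i - μ i) = a * μ i + b * ν i := fun i => by
    rw [← sub_eq_of_eq_add hab.symm]
    ring
  simpa [hκdef, hb'] using h
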